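/- Let R be a non-negatively graded algebra over a local ring R_0 with dim R = d, let 𝔪 be the maximal homogeneous ideal of R, let M be a graded R-module, and let C_• : ⋯ → C_1 → C_0 → 0 be a homogeneous complex of finitely generated graded R-modules with H_0(C_•) = M. Assume: (a) j + 1 ≤ depth C_j for all j with 0 ≤ j ≤ d − 1, and (b) dim H_j(C_•) ≤ j for all j ≥ 1. Then: (i) if C_d = 0, then H^0_𝔪(M) = 0; (ii) if C_d ≠ 0, then [H^0_𝔪(M)]_ℓ = 0 for all ℓ with b_0(C_d) + a(R) < ℓ. -/

import Mathlib

/-!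
Statement 1 (Corollary `cor-to-localCoh-1` of the paper, the case `i = 0`).

Same setting as Lemma `localCoh`: `R` non-negatively graded over a local ring
`R₀ = 𝒜 0`, of dimension `d`, maximal homogeneous ideal `𝔪`, `M` a graded module,
`C_•` a homogeneous complex of finitely generated graded modules with `H₀(C_•) = M`,
with `j + 1 ≤ depth C_j` for `0 ≤ j ≤ d-1` and `dim H_j(C_•) ≤ j` for `j ≥ 1`.  Then:

(i)  if `C_d = 0` then `H⁰_𝔪(M) = 0`;
(ii) if `C_d ≠ 0` then `[H⁰_𝔪(M)]_ℓ = 0` for all `ℓ > b₀(C_d) + a(R)`.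

Here `H⁰_𝔪(M)` is the `𝔪`-power-torsion submodule of `M`, and the `a`-invariant
`a(R) = topdeg H^d_𝔪(R)` is expressed through Koszul-cohomology direct limits
(`KVanish`), in the universally quantified form: for every upper bound `β` of `b₀(C_d)`
and every `γ` with `[H^d_𝔪(R)]_ℓ = 0` for all `ℓ > γ` (i.e. `a(R) ≤ γ`), the
degree-`ℓ` component of `H⁰_𝔪(M)` vanishes for all `ℓ > β + γ`.
-/

noncomputable section
namespace Paper

variable {R : Type} [CommRing R]

def maxHomIdeal (𝒜 : ℤ → AddSubgroup R) [GradedRing 𝒜] : Ideal R :=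
  Ideal.span ({ r : R | ∃ h : r ∈ 𝒜 0, ¬ IsUnit (⟨r, h⟩ : 𝒜 0) } ∪
    ⋃ (i : ℤ) (_ : i ≠ 0), (𝒜 i : Set R))

def GenDegLE {M : Type} [AddCommGroup M] [Module R M] (ℳ : ℤ → AddSubgroup M) (b : ℤ) : Prop :=
  Submodule.span R (⋃ (j : ℤ) (_ : j ≤ b), (ℳ j : Set M)) = ⊤

def depthGE (I : Ideal R) (N : Type) [AddCommGroup N] [Module R N] (k : ℕ) : Prop :=
  Subsingleton N ∨ ∃ rs : List R, rs.length = k ∧ (∀ r ∈ rs, r ∈ I) ∧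
    RingTheory.Sequence.IsRegular N rs

def modDimLE (N : Type) [AddCommGroup N] [Module R N] (b : ℕ) : Prop :=
  ringKrullDim (R ⧸ Module.annihilator R N) ≤ (b : WithBot (WithTop ℕ))

/-- The `0`-th local cohomology `H⁰_I(M)`: the `I`-power-torsion submodule of `M`. -/
def torsionSubmodule (I : Ideal R) (M : Type) [AddCommGroup M] [Module R M] :
    Submodule R M where
  carrier := { x | ∃ t : ℕ, ∀ r ∈ I ^ t, r • x = 0 }
  zero_mem' := ⟨0, fun r _ => smul_zero r⟩
  add_mem' := by
    rintro a b ⟨t, ht⟩ ⟨m, hm⟩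
    refine ⟨t + m, fun r hr => ?_⟩
    have h1 : r ∈ I ^ t := Ideal.pow_le_pow_right (Nat.le_add_right t m) hr
    have h2 : r ∈ I ^ m := Ideal.pow_le_pow_right (Nat.le_add_left m t) hr
    rw [smul_add, ht r h1, hm r h2, add_zero]
  smul_mem' := by
    rintro c x ⟨t, ht⟩
    exact ⟨t, fun r hr => by rw [smul_comm, ht r hr, smul_zero]⟩

abbrev KCochain (n : ℕ) (M : Type) (i : ℕ) : Type := {S : Finset (Fin n) // S.card = i} → M

variable {n : ℕ} (y : Fin n → R) {M : Type} [AddCommGroup M] [Module R M]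

def kd (t i : ℕ) (f : KCochain n M i) : KCochain n M (i + 1) := fun T =>
  ∑ j ∈ T.1.attach,
    ((-1 : ℤ) ^ ((T.1.filter (fun a => a < j.1)).card)) •
      ((y j.1 ^ t) • f ⟨T.1.erase j.1, by simp [Finset.card_erase_of_mem j.2, T.2]⟩)

def kTrans (s : ℕ) (i : ℕ) (f : KCochain n M i) : KCochain n M i := fun S =>
  ((∏ j ∈ S.1, y j) ^ s) • f S

def KHomog (ℳ : ℤ → AddSubgroup M) (e : Fin n → ℤ) (t : ℕ) (ℓ : ℤ) {i : ℕ}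
    (f : KCochain n M i) : Prop :=
  ∀ S, f S ∈ ℳ (ℓ + (t : ℤ) * ∑ j ∈ S.1, e j)

def IsKBoundary (t : ℕ) : (i : ℕ) → KCochain n M i → Prop
  | 0, f => f = 0
  | (i + 1), f => ∃ g : KCochain n M i, kd y t i g = f

def KVanish (ℳ : ℤ → AddSubgroup M) (e : Fin n → ℤ) (i : ℕ) (ℓ : ℤ) : Prop :=
  ∀ (t : ℕ) (f : KCochain n M i), kd y t i f = 0 → KHomog ℳ e t ℓ f →
    ∃ s : ℕ, IsKBoundary y (t + s) i (kTrans y s i f)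

abbrev Hmod (C : ℕ → Type) [∀ j, AddCommGroup (C j)] [∀ j, Module R (C j)]
    (dl : ∀ j, C (j + 1) →ₗ[R] C j) (j : ℕ) : Type :=
  ↥(LinearMap.ker (dl j)) ⧸
    (Submodule.comap (LinearMap.ker (dl j)).subtype (LinearMap.range (dl (j + 1))))

section Koszul

/-- The sign with which the index `j` enters the Koszul differential at `T`. -/
def kSign (j : Fin n) (T : Finset (Fin n)) : ℤ := (-1) ^ (T.filter (fun a => a < j)).card

/-- The Koszul differential on functions on all subsets of `Fin n`. -/
def kTot (t : ℕ) (F : Finset (Fin n) → M) (T : Finset (Fin n)) : M :=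
  ∑ j ∈ T, kSign j T • (y j ^ t • F (T.erase j))

/-- Extension of a Koszul cochain by zero to all subsets. -/
def kExt {i : ℕ} (f : KCochain n M i) (S : Finset (Fin n)) : M :=
  if h : S.card = i then f ⟨S, h⟩ else 0

/-- The contraction by `j`, a homotopy between multiplication by `y j ^ t` and zero. -/
def kContr (j : Fin n) (F : Finset (Fin n) → M) (S : Finset (Fin n)) : M :=
  if j ∈ S then 0 else kSign j S • F (insert j S)

lemma kSign_mul_self (j : Fin n) (T : Finset (Fin n)) : kSign j T * kSign j T = 1 := by
  unfold kSign
  rw [← mul_pow]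
  simp

lemma kSign_erase_self (j : Fin n) (T : Finset (Fin n)) :
    kSign j (T.erase j) = kSign j T := by
  unfold kSign
  congr 2
  ext a
  simp only [Finset.mem_filter, Finset.mem_erase]
  constructor
  · rintro ⟨⟨_, h⟩, h'⟩
    exact ⟨h, h'⟩
  · rintro ⟨h, h'⟩
    exact ⟨⟨h'.ne, h⟩, h'⟩

lemma kSign_insert (j k : Fin n) (T : Finset (Fin n)) (hj : j ∉ T) :
    kSign k (insert j T) = (if j < k then -1 else 1) * kSign k T := by
  unfold kSign
  rw [Finset.filter_insert]
  split_ifs with h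
  · rw [Finset.card_insert_of_notMem (by simp [hj]), pow_succ, mul_comm]
  · simp

lemma kSign_erase (j k : Fin n) (T : Finset (Fin n)) (hj : j ∈ T) :
    kSign k (T.erase j) = (if j < k then -1 else 1) * kSign k T := by
  have h := kSign_insert j k (T.erase j) (Finset.notMem_erase j T)
  rw [Finset.insert_erase hj] at h
  rw [h]
  split_ifs <;> simp

lemma kd_apply (t i : ℕ) (f : KCochain n M i) (T : {S : Finset (Fin n) // S.card = i + 1}) :
    kd y t i f T = kTot y t (kExt f) T.1 := by
  unfold kd kTot
  rw [← Finset.sum_attach T.1]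
  refine Finset.sum_congr rfl fun j _ => ?_
  have h : (T.1.erase j.1).card = i := by simp [Finset.card_erase_of_mem j.2, T.2]
  simp [kSign, kExt, h]

lemma kExt_kd (t i : ℕ) (f : KCochain n M i) : kExt (kd y t i f) = kTot y t (kExt f) := by
  funext T
  by_cases h : T.card = i + 1
  · rw [← kd_apply y t i f ⟨T, h⟩]
    simp [kExt, h]
  · rw [kExt, dif_neg h, kTot]
    refine (Finset.sum_eq_zero fun j hj => ?_).symm
    have h' : (T.erase j).card ≠ i := by
      have := Finset.card_erase_add_one hj
      omega
    simp [kExt, h']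

lemma kTot_kTot (t : ℕ) (F : Finset (Fin n) → M) : kTot y t (kTot y t F) = 0 := by
  funext T
  simp only [kTot, Finset.smul_sum, Pi.zero_apply]
  rw [Finset.sum_sigma']
  refine Finset.sum_involution (fun p _ => ⟨p.2, p.1⟩) ?_ ?_ ?_ ?_
  · rintro ⟨j, k⟩ h
    simp only [Finset.mem_sigma, Finset.mem_erase] at h
    obtain ⟨hj, hkj, hk⟩ := h
    rw [kSign_erase j k T hj, kSign_erase k j T hk, Finset.erase_right_comm (a := k)]
    simp only [smul_comm (y _ ^ t) (_ : ℤ), smul_smul]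
    rw [mul_comm (y k ^ t), ← add_smul]
    convert zero_smul ℤ _
    rcases lt_or_gt_of_ne hkj with h | h
    · simp [h, h.not_gt]; ring
    · simp [h, h.not_gt]; ring
  · rintro ⟨j, k⟩ h _ heq
    simp only [Finset.mem_sigma, Finset.mem_erase] at h
    simp only [Sigma.mk.injEq] at heq
    exact h.2.1 heq.1
  · rintro ⟨j, k⟩ h
    simp only [Finset.mem_sigma, Finset.mem_erase] at h ⊢
    exact ⟨h.2.2, h.2.1.symm, h.1⟩
  · rintro ⟨j, k⟩ h
    rfl

lemma kd_kd (t i : ℕ) (f : KCochain n M i) : kd y t (i + 1) (kd y t i f) = 0 := by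
  funext T
  rw [kd_apply, kExt_kd, kTot_kTot]
  rfl

lemma kTot_kContr_add (t : ℕ) (j : Fin n) (F : Finset (Fin n) → M) (S : Finset (Fin n)) :
    kTot y t (kContr j F) S + kContr j (kTot y t F) S = y j ^ t • F S := by
  by_cases hj : j ∈ S
  · rw [kContr, if_pos hj, add_zero, kTot, Finset.sum_eq_single j]
    · rw [kContr, if_neg (Finset.notMem_erase j S), kSign_erase_self, Finset.insert_erase hj,
        smul_comm (y j ^ t), smul_smul, kSign_mul_self, one_smul]
    · intro k _ hkj
      rw [kContr, if_pos (Finset.mem_erase.2 ⟨hkj.symm, hj⟩), smul_zero, smul_zero]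
    · exact fun h => absurd hj h
  · rw [kContr, if_neg hj, kTot, kTot, Finset.sum_insert hj, smul_add, smul_smul,
      Finset.erase_insert hj, ← kSign_erase_self j (insert j S), Finset.erase_insert hj,
      kSign_mul_self, one_smul, add_left_comm, Finset.smul_sum, ← Finset.sum_add_distrib,
      Finset.sum_eq_zero, add_zero]
    intro k hk
    have hkj : k ≠ j := fun h => hj (h ▸ hk)
    rw [kContr, if_neg (fun h => hj (Finset.mem_of_mem_erase h)), kSign_insert j k S hj,
      kSign_erase k j S hk, Finset.erase_insert_of_ne hkj.symm]
    simp only [smul_comm (y _ ^ t) (_ : ℤ), smul_smul, ← add_smul]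
    convert zero_smul ℤ _
    rcases lt_or_gt_of_ne hkj with h | h
    · simp [h, h.not_gt]; ring
    · simp [h, h.not_gt]; ring

lemma exists_kd_eq_smul (t i : ℕ) (j : Fin n) (f : KCochain n M (i + 1))
    (hf : kd y t (i + 1) f = 0) : ∃ g, kd y t i g = y j ^ t • f := by
  refine ⟨fun S => kContr j (kExt f) S.1, ?_⟩
  funext S
  have hg : kExt (fun S : {S : Finset (Fin n) // S.card = i} => kContr j (kExt f) S.1) =
      kContr j (kExt f) := by
    funext S
    by_cases h : S.card = i
    · simp [kExt, h]
    · rw [kExt, dif_neg h, kContr]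
      split_ifs with hj
      · rfl
      · have h' : (insert j S).card ≠ i + 1 := by
          rw [Finset.card_insert_of_notMem hj]
          omega
        simp [kExt, h']
  have h := kTot_kContr_add y t j (kExt f) S.1
  rw [← kExt_kd, hf] at h
  rw [kd_apply, hg]
  have h0 : kExt (0 : KCochain n M (i + 1 + 1)) = 0 := by
    funext T
    simp [kExt]
  rw [h0] at h
  simpa [kContr, kExt, S.2] using h

lemma smul_eq_zero_of_kd_eq_zero (t : ℕ) (j : Fin n) (f : KCochain n M 0)
    (hf : kd y t 0 f = 0) : y j ^ t • f = 0 := by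
  funext ⟨S, hS⟩
  obtain rfl : S = ∅ := Finset.card_eq_zero.1 hS
  have h := kTot_kContr_add y t j (kExt f) ∅
  rw [← kExt_kd, hf] at h
  simpa [kTot, kContr, kExt] using h.symm

end Koszul

section Cochain

variable {N : Type} [AddCommGroup N] [Module R N]

lemma kd_map (φ : M →ₗ[R] N) (t i : ℕ) (f : KCochain n M i) :
    kd y t i (fun S => φ (f S)) = fun T => φ (kd y t i f T) := by
  funext T
  simp [kd, map_sum]

lemma kd_add (t i : ℕ) (f g : KCochain n M i) :
    kd y t i (f + g) = kd y t i f + kd y t i g := by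
  funext T
  simp [kd, Finset.sum_add_distrib]

lemma kd_sub (t i : ℕ) (f g : KCochain n M i) :
    kd y t i (f - g) = kd y t i f - kd y t i g := by
  funext T
  simp [kd, smul_sub, Finset.sum_sub_distrib]

lemma kd_smul (t i : ℕ) (r : R) (f : KCochain n M i) :
    kd y t i (r • f) = r • kd y t i f := by
  funext T
  exact congrFun (kd_map y (LinearMap.lsmul R M r) t i f) T

lemma kd_zero (t i : ℕ) : kd y t i (0 : KCochain n M i) = 0 := by
  funext T
  simp [kd]

lemma kTrans_map (φ : M →ₗ[R] N) (s i : ℕ) (f : KCochain n M i) :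
    kTrans y s i (fun S => φ (f S)) = fun T => φ (kTrans y s i f T) := by
  funext T
  simp [kTrans]

lemma kTrans_add (s i : ℕ) (f g : KCochain n M i) :
    kTrans y s i (f + g) = kTrans y s i f + kTrans y s i g := by
  funext T
  simp [kTrans]

lemma kTrans_smul (s i : ℕ) (r : R) (f : KCochain n M i) :
    kTrans y s i (r • f) = r • kTrans y s i f := by
  funext T
  simp only [kTrans, Pi.smul_apply]
  rw [smul_comm]

lemma kTrans_zero (s i : ℕ) : kTrans y s i (0 : KCochain n M i) = 0 := by
  funext T
  simp [kTrans]

lemma kTrans_kTrans (s s' i : ℕ) (f : KCochain n M i) :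
    kTrans y s' i (kTrans y s i f) = kTrans y (s + s') i f := by
  funext T
  simp only [kTrans, smul_smul, pow_add]
  rw [mul_comm]

lemma kTrans_kd (s t i : ℕ) (f : KCochain n M i) :
    kTrans y s (i + 1) (kd y t i f) = kd y (t + s) i (kTrans y s i f) := by
  funext T
  simp only [kTrans, kd, Finset.smul_sum]
  refine Finset.sum_congr rfl fun j _ => ?_
  rw [smul_comm _ ((-1 : ℤ) ^ _), smul_smul, smul_smul, ← Finset.mul_prod_erase T.1 y j.2]
  congr 2
  ring

end Cochain

/-- A compatible family of idempotent endomorphisms on the components of the Koszul complexes of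
`N`, whose images are the homogeneous components of a fixed degree. -/
structure KProj (N : Type) [AddCommGroup N] [Module R N] where
  p : ℕ → Finset (Fin n) → N →+ N
  p_p : ∀ t S x, p t S (p t S x) = p t S x
  p_smul : ∀ (t : ℕ) (T : Finset (Fin n)) (j : Fin n), j ∈ T → ∀ x,
    p t T (y j ^ t • x) = y j ^ t • p t (T.erase j) x
  p_trans : ∀ (t s : ℕ) (S : Finset (Fin n)) x,
    p (t + s) S ((∏ j ∈ S, y j) ^ s • x) = (∏ j ∈ S, y j) ^ s • p t S x

namespace KProj

variable {y} {N : Type} [AddCommGroup N] [Module R N]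

variable (y) in
/-- The identity family, for which every cochain is homogeneous. -/
def triv (N : Type) [AddCommGroup N] [Module R N] : KProj y N where
  p _ _ := AddMonoidHom.id N
  p_p _ _ _ := rfl
  p_smul _ _ _ _ _ := rfl
  p_trans _ _ _ _ := rfl

/-- The restriction of a family of projections to a stable submodule. -/
def restrict (P : KProj y N) (W : Submodule R N) (hW : ∀ t S, ∀ x ∈ W, P.p t S x ∈ W) :
    KProj y W where
  p t S := ((P.p t S).comp W.subtype.toAddMonoidHom).codRestrict W.toAddSubgroup
    fun x => hW t S x x.2
  p_p t S x := Subtype.ext (P.p_p t S x)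
  p_smul t T j hj x := Subtype.ext (P.p_smul t T j hj x)
  p_trans t s S x := Subtype.ext (P.p_trans t s S x)

/-- A cochain is homogeneous if it is fixed by the projections. -/
def Homog (P : KProj y N) (t : ℕ) {i : ℕ} (f : KCochain n N i) : Prop :=
  ∀ S, P.p t S.1 (f S) = f S

/-- The homogeneous part of a cochain. -/
def proj (P : KProj y N) (t : ℕ) {i : ℕ} (f : KCochain n N i) : KCochain n N i :=
  fun S => P.p t S.1 (f S)

/-- Coboundaries of homogeneous cochains. -/
def IsBd (P : KProj y N) (t : ℕ) : (i : ℕ) → KCochain n N i → Prop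
  | 0, f => f = 0
  | (i + 1), f => ∃ g, P.Homog t g ∧ kd y t i g = f

/-- Vanishing of the homogeneous part of the direct limit of Koszul cohomologies. -/
def Vanish (P : KProj y N) (i : ℕ) : Prop :=
  ∀ (t : ℕ) (f : KCochain n N i), kd y t i f = 0 → P.Homog t f →
    ∃ s : ℕ, P.IsBd (t + s) i (kTrans y s i f)

lemma homog_triv (t : ℕ) {i : ℕ} (f : KCochain n N i) : (triv y N).Homog t f := fun _ => rfl

lemma homog_proj (P : KProj y N) (t : ℕ) {i : ℕ} (f : KCochain n N i) :
    P.Homog t (P.proj t f) := fun S => P.p_p t S.1 (f S)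

lemma Homog.proj_eq {P : KProj y N} {t i : ℕ} {f : KCochain n N i} (hf : P.Homog t f) :
    P.proj t f = f := funext hf

lemma proj_sub (P : KProj y N) (t : ℕ) {i : ℕ} (f g : KCochain n N i) :
    P.proj t (f - g) = P.proj t f - P.proj t g := by
  funext S
  simp [proj]

lemma kd_proj (P : KProj y N) (t : ℕ) {i : ℕ} (f : KCochain n N i) :
    kd y t i (P.proj t f) = P.proj t (kd y t i f) := by
  funext T
  simp only [kd, proj, map_sum, map_zsmul]
  refine Finset.sum_congr rfl fun j _ => ?_
  rw [P.p_smul t T.1 j.1 j.2]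

lemma Homog.kTrans {P : KProj y N} {t i : ℕ} {f : KCochain n N i} (hf : P.Homog t f) (s : ℕ) :
    P.Homog (t + s) (kTrans y s i f) := fun S => by
  rw [Paper.kTrans, P.p_trans, hf S]

lemma Homog.sub {P : KProj y N} {t i : ℕ} {f g : KCochain n N i} (hf : P.Homog t f)
    (hg : P.Homog t g) : P.Homog t (f - g) := fun S => by
  simp [hf S, hg S]

lemma Homog.add {P : KProj y N} {t i : ℕ} {f g : KCochain n N i} (hf : P.Homog t f)
    (hg : P.Homog t g) : P.Homog t (f + g) := fun S => by
  simp [hf S, hg S]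

lemma isBd_zero (P : KProj y N) (t i : ℕ) : P.IsBd t i 0 := by
  cases i with
  | zero => rfl
  | succ i => exact ⟨0, fun S => by simp, kd_zero y t i⟩

lemma IsBd.add {P : KProj y N} {t i : ℕ} {f g : KCochain n N i} (hf : P.IsBd t i f)
    (hg : P.IsBd t i g) : P.IsBd t i (f + g) := by
  cases i with
  | zero =>
    obtain rfl : f = 0 := hf
    obtain rfl : g = 0 := hg
    exact zero_add _
  | succ i =>
    obtain ⟨u, hu, rfl⟩ := hf
    obtain ⟨v, hv, rfl⟩ := hg
    exact ⟨u + v, hu.add hv, kd_add y t i u v⟩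

lemma IsBd.smul_triv {t i : ℕ} {f : KCochain n N i} (hf : (triv y N).IsBd t i f) (r : R) :
    (triv y N).IsBd t i (r • f) := by
  cases i with
  | zero =>
    obtain rfl : f = 0 := hf
    exact smul_zero r
  | succ i =>
    obtain ⟨u, -, rfl⟩ := hf
    exact ⟨r • u, homog_triv _ _, kd_smul y t i r u⟩

lemma IsBd.kTrans {P : KProj y N} {t i : ℕ} {f : KCochain n N i} (hf : P.IsBd t i f) (s : ℕ) :
    P.IsBd (t + s) i (kTrans y s i f) := by
  cases i with
  | zero =>
    obtain rfl : f = 0 := hf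
    exact kTrans_zero y s 0
  | succ i =>
    obtain ⟨u, hu, rfl⟩ := hf
    exact ⟨_, hu.kTrans s, (kTrans_kd y s t i u).symm⟩

lemma IsBd.kTrans_of_le {P : KProj y N} {t i s s' : ℕ} {f : KCochain n N i}
    (hf : P.IsBd (t + s) i (Paper.kTrans y s i f)) (h : s ≤ s') :
    P.IsBd (t + s') i (Paper.kTrans y s' i f) := by
  obtain ⟨k, rfl⟩ := Nat.exists_eq_add_of_le h
  rw [← kTrans_kTrans, ← add_assoc]
  exact hf.kTrans k

lemma IsBd.kd_eq_zero {P : KProj y N} {t i : ℕ} {f : KCochain n N i} (hf : P.IsBd t i f) :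
    kd y t i f = 0 := by
  cases i with
  | zero =>
    obtain rfl : f = 0 := hf
    exact kd_zero y t 0
  | succ i =>
    obtain ⟨u, hu, rfl⟩ := hf
    exact kd_kd y t i u

lemma IsBd.proj {t i : ℕ} {f : KCochain n N i} (hf : (triv y N).IsBd t i f) (P : KProj y N) :
    P.IsBd t i (P.proj t f) := by
  cases i with
  | zero =>
    obtain rfl : f = 0 := hf
    funext S
    simp [KProj.proj]
  | succ i =>
    obtain ⟨u, -, rfl⟩ := hf
    exact ⟨_, P.homog_proj t u, P.kd_proj t u⟩

lemma Vanish.of_triv {i : ℕ} (h : (triv y N).Vanish i) (P : KProj y N) : P.Vanish i := by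
  intro t f hf hP
  obtain ⟨s, hs⟩ := h t f hf (homog_triv _ _)
  refine ⟨s, ?_⟩
  rw [← (hP.kTrans s).proj_eq]
  exact hs.proj P

lemma vanish_of_subsingleton [Subsingleton N] (P : KProj y N) (i : ℕ) : P.Vanish i := by
  intro t f _ _
  refine ⟨0, ?_⟩
  rw [Subsingleton.elim (Paper.kTrans y 0 i f) 0]
  exact P.isBd_zero _ _

section Exact

variable {A B C : Type} [AddCommGroup A] [Module R A] [AddCommGroup B] [Module R B]
  [AddCommGroup C] [Module R C]

lemma IsBd.map {PA : KProj y A} {PB : KProj y B} (φ : A →ₗ[R] B)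
    (hφ : ∀ t S x, φ (PA.p t S x) = PB.p t S (φ x)) {t i : ℕ} {f : KCochain n A i}
    (hf : PA.IsBd t i f) : PB.IsBd t i (fun S => φ (f S)) := by
  cases i with
  | zero =>
    obtain rfl : f = 0 := hf
    funext S
    simp
  | succ i =>
    obtain ⟨u, hu, rfl⟩ := hf
    refine ⟨fun S => φ (u S), fun S => ?_, kd_map y φ t i u⟩
    rw [← hφ, hu S]

lemma IsBd.exists_lift {g : B →ₗ[R] C} (hg : Function.Surjective g) {t i : ℕ}
    {f : KCochain n C i} (hf : (triv y C).IsBd t i f) :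
    ∃ v, (triv y B).IsBd t i v ∧ (fun S => g (v S)) = f := by
  cases i with
  | zero =>
    obtain rfl : f = 0 := hf
    exact ⟨0, rfl, by funext S; simp⟩
  | succ i =>
    obtain ⟨u, hu, rfl⟩ := hf
    choose v hv using fun S => hg (u S)
    refine ⟨kd y t i v, ⟨v, homog_triv _ _, rfl⟩, ?_⟩
    rw [← kd_map]
    simp only [hv]

lemma Vanish.middle {PA : KProj y A} {PB : KProj y B} {α : A →ₗ[R] B} {g : B →ₗ[R] C}
    (hα : Function.Injective α) (hg : Function.Surjective g) (hαg : Function.Exact α g)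
    (hαp : ∀ t S x, α (PA.p t S x) = PB.p t S (α x)) {i : ℕ}
    (hA : PA.Vanish i) (hC : (triv y C).Vanish i) : PB.Vanish i := by
  intro t f hf hP
  obtain ⟨s, hs⟩ := hC t (fun S => g (f S)) (by rw [kd_map, hf]; funext S; simp)
    (homog_triv _ _)
  rw [kTrans_map] at hs
  obtain ⟨v, hv, hgv⟩ := hs.exists_lift hg
  have hw : ∀ S, ∃ x, α x = (kTrans y s i f - v) S := fun S => by
    refine (hαg _).1 ?_
    rw [Pi.sub_apply, map_sub, ← congrFun hgv S, sub_self]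
  choose h hh using hw
  have hdh : kd y (t + s) i h = 0 := by
    funext S
    apply hα
    have h1 := congrFun (kd_map y α (t + s) i h) S
    rw [← h1]
    simp only [hh]
    rw [kd_sub, ← kTrans_kd, hf, kTrans_zero, hv.kd_eq_zero]
    simp
  obtain ⟨s', hs'⟩ := hA (t + s) (PA.proj (t + s) h)
    (by rw [kd_proj, hdh]; funext S; simp [KProj.proj]) (PA.homog_proj _ _)
  refine ⟨s + s', ?_⟩
  have key : kTrans y s i f = (fun S => α (PA.proj (t + s) h S)) + PB.proj (t + s) v := by
    have h2 : (fun S => α (PA.proj (t + s) h S)) = PB.proj (t + s) (kTrans y s i f - v) := by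
      funext S
      simp only [KProj.proj, hαp, hh]
    rw [h2, proj_sub, sub_add_cancel, (hP.kTrans s).proj_eq]
  rw [← kTrans_kTrans, key, kTrans_add, ← add_assoc, kTrans_map]
  exact (hs'.map α hαp).add ((hv.proj PB).kTrans s')

lemma Vanish.right {PA : KProj y A} {PB : KProj y B} {PC : KProj y C} {α : A →ₗ[R] B}
    {g : B →ₗ[R] C} (hα : Function.Injective α) (hg : Function.Surjective g)
    (hαg : Function.Exact α g) (hαp : ∀ t S x, α (PA.p t S x) = PB.p t S (α x))
    (hgp : ∀ t S x, g (PB.p t S x) = PC.p t S (g x)) {i : ℕ}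
    (hB : PB.Vanish i) (hA : PA.Vanish (i + 1)) : PC.Vanish i := by
  intro t f hf hP
  choose v₀ hv₀ using fun S => hg (f S)
  obtain ⟨v, hv, hgv⟩ : ∃ v, PB.Homog t v ∧ (fun S => g (v S)) = f := by
    refine ⟨PB.proj t v₀, PB.homog_proj t v₀, ?_⟩
    funext S
    simp only [KProj.proj, hgp, hv₀]
    exact hP S
  have hw : ∀ S, ∃ x, α x = kd y t i v S := fun S => by
    refine (hαg _).1 ?_
    rw [← congrFun (kd_map y g t i v) S, hgv, hf]
    rfl
  choose h hh using hw
  have hdh : kd y t (i + 1) h = 0 := by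
    funext S
    apply hα
    rw [← congrFun (kd_map y α t (i + 1) h) S]
    simp only [hh]
    rw [kd_kd]
    simp
  have hPh : PA.Homog t h := fun S => by
    apply hα
    rw [hαp, hh]
    exact congrFun ((PB.kd_proj t v).symm.trans (by rw [hv.proj_eq])) S
  obtain ⟨s, u, hu, hus⟩ := hA t h hdh hPh
  have hαu : PB.Homog (t + s) (fun S => α (u S)) := fun S => by rw [← hαp, hu S]
  obtain ⟨s', hs'⟩ := hB (t + s) (kTrans y s i v - fun S => α (u S)) (by
    rw [kd_sub, ← kTrans_kd, kd_map, hus, ← kTrans_map]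
    simp only [hh]
    exact sub_self _) ((hv.kTrans s).sub hαu)
  refine ⟨s + s', ?_⟩
  have key : (fun S => g ((kTrans y s i v - fun S => α (u S)) S)) = kTrans y s i f := by
    rw [← hgv, kTrans_map]
    funext S
    have : g (α (u S)) = 0 := hαg.apply_apply_eq_zero _
    simp [this]
  rw [← kTrans_kTrans, ← key, ← add_assoc, kTrans_map]
  exact hs'.map g hgp

end Exact

/-- The ideal of elements annihilating the class of a cochain in the direct limit of Koszul
cohomologies. -/
def bdIdeal (y : Fin n → R) (t i : ℕ) (f : KCochain n N i) : Ideal R where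
  carrier := { r | ∃ s, (triv y N).IsBd (t + s) i (kTrans y s i (r • f)) }
  zero_mem' := ⟨0, by rw [zero_smul, kTrans_zero]; exact isBd_zero _ _ _⟩
  add_mem' := by
    rintro a b ⟨s, hs⟩ ⟨s', hs'⟩
    refine ⟨max s s', ?_⟩
    rw [add_smul, kTrans_add]
    exact (hs.kTrans_of_le (le_max_left s s')).add (hs'.kTrans_of_le (le_max_right s s'))
  smul_mem' := by
    rintro c a ⟨s, hs⟩
    refine ⟨s, ?_⟩
    rw [smul_eq_mul, mul_smul, kTrans_smul]
    exact hs.smul_triv c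

lemma span_le_radical_bdIdeal {t i : ℕ} {f : KCochain n N i} (hf : kd y t i f = 0) :
    (Ideal.span (Set.range y)).radical ≤ (bdIdeal y t i f).radical := by
  rw [Ideal.radical_le_radical_iff, Ideal.span_le]
  rintro _ ⟨j, rfl⟩
  refine ⟨t, 0, ?_⟩
  cases i with
  | zero =>
    rw [smul_eq_zero_of_kd_eq_zero y t j f hf, kTrans_zero]
    exact isBd_zero _ _ _
  | succ i =>
    obtain ⟨g, hg⟩ := exists_kd_eq_smul y t i j f hf
    have hbd : (triv y N).IsBd t (i + 1) (y j ^ t • f) := ⟨g, homog_triv _ _, hg⟩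
    exact hbd.kTrans 0

lemma vanish_of_one_mem {i : ℕ}
    (h : ∀ (t : ℕ) (f : KCochain n N i), kd y t i f = 0 → 1 ∈ bdIdeal y t i f) :
    (triv y N).Vanish i := by
  intro t f hf _
  obtain ⟨s, hs⟩ := h t f hf
  exact ⟨s, by rwa [one_smul] at hs⟩

lemma vanish_of_cancel {r : R} (hr : r ∈ (Ideal.span (Set.range y)).radical) {i : ℕ}
    (h : ∀ (t : ℕ) (f : KCochain n N i), kd y t i f = 0 → r ∈ bdIdeal y t i f →
      1 ∈ bdIdeal y t i f) : (triv y N).Vanish i := by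
  refine vanish_of_one_mem fun t f hf => ?_
  obtain ⟨k, hk⟩ := span_le_radical_bdIdeal hf hr
  induction k with
  | zero => simpa using hk
  | succ k ih =>
    refine ih ?_
    obtain ⟨s, hs⟩ := h t (r ^ k • f) (by rw [kd_smul, hf, smul_zero]) (by
      obtain ⟨s, hs⟩ := hk
      exact ⟨s, by rwa [smul_smul, ← pow_succ']⟩)
    exact ⟨s, by rwa [one_smul] at hs⟩

lemma vanish_zero_of_isSMulRegular {r : R} (hr : r ∈ (Ideal.span (Set.range y)).radical)
    (hreg : IsSMulRegular N r) : (triv y N).Vanish 0 := by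
  refine vanish_of_cancel hr fun t f _ => ?_
  rintro ⟨s, hs⟩
  refine ⟨s, ?_⟩
  have hs : kTrans y s 0 (r • f) = 0 := hs
  rw [one_smul]
  change kTrans y s 0 f = 0
  rw [kTrans_smul] at hs
  funext S
  exact hreg.right_eq_zero_of_smul (congrFun hs S)

open scoped Pointwise in
lemma vanish_succ_of_isSMulRegular {r : R} (hr : r ∈ (Ideal.span (Set.range y)).radical)
    (hreg : IsSMulRegular N r) {i : ℕ} (h : (triv y (QuotSMulTop r N)).Vanish i) :
    (triv y N).Vanish (i + 1) := by
  refine vanish_of_cancel hr fun t f _ => ?_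
  rintro ⟨s, u, -, hu⟩
  let q : N →ₗ[R] QuotSMulTop r N := (r • (⊤ : Submodule R N)).mkQ
  have hq : ∀ x, q (r • x) = 0 := fun x =>
    (Submodule.Quotient.mk_eq_zero _).2 (Submodule.smul_mem_pointwise_smul _ _ _ Submodule.mem_top)
  obtain ⟨s', hs'⟩ := h (t + s) (fun S => q (u S)) (by
    rw [kd_map, hu, kTrans_smul]
    funext S
    exact hq _) (homog_triv _ _)
  rw [kTrans_map] at hs'
  obtain ⟨v, hv, hqv⟩ := hs'.exists_lift (Submodule.mkQ_surjective _)
  have hw : ∀ S, ∃ x, r • x = (kTrans y s' i u - v) S := fun S => by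
    have h1 : (kTrans y s' i u - v) S ∈ r • (⊤ : Submodule R N) := by
      rw [← Submodule.Quotient.mk_eq_zero]
      change q _ = 0
      rw [Pi.sub_apply, map_sub, ← congrFun hqv S]
      exact sub_self _
    obtain ⟨x, -, hx⟩ := h1
    exact ⟨x, hx⟩
  choose w hw using hw
  refine ⟨s + s', w, homog_triv _ _, ?_⟩
  rw [one_smul, ← kTrans_kTrans, ← add_assoc]
  have h2 : r • kd y (t + s + s') i w = r • kTrans y s' (i + 1) (kTrans y s (i + 1) f) := by
    rw [← kd_smul, show r • w = kTrans y s' i u - v from funext hw, kd_sub, hv.kd_eq_zero,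
      sub_zero, ← kTrans_kd, hu, kTrans_smul, kTrans_smul]
  funext S
  exact hreg (congrFun h2 S)

end KProj

section Vanishing

variable {y} {N : Type} [AddCommGroup N] [Module R N]

open KProj

lemma vanish_of_isWeaklyRegular (rs : List R) (N : Type) [AddCommGroup N] [Module R N]
    (hrs : ∀ r ∈ rs, r ∈ (Ideal.span (Set.range y)).radical)
    (h : RingTheory.Sequence.IsWeaklyRegular N rs) {i : ℕ} (hi : i < rs.length) :
    (triv y N).Vanish i := by
  induction rs generalizing N i with
  | nil => simp at hi
  | cons r rs ih =>
    rw [RingTheory.Sequence.isWeaklyRegular_cons_iff] at h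
    have hr := hrs r List.mem_cons_self
    cases i with
    | zero => exact vanish_zero_of_isSMulRegular hr h.1
    | succ i =>
      exact vanish_succ_of_isSMulRegular hr h.1
        (ih (QuotSMulTop r N) (fun a ha => hrs a (List.mem_cons_of_mem r ha)) h.2
          (by simpa using hi))

lemma ringKrullDim_quotient_anti {I J : Ideal R} (h : I ≤ J) :
    ringKrullDim (R ⧸ J) ≤ ringKrullDim (R ⧸ I) :=
  ringKrullDim_le_of_surjective (Ideal.Quotient.factor h) (Ideal.Quotient.factor_surjective h)

lemma ringKrullDim_quotient_sup_span_lt {p : Ideal R} [p.IsPrime] {r : R} (hr : r ∉ p) {b : ℕ}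
    (hb : ringKrullDim (R ⧸ p) < (b + 1 : ℕ)) :
    ringKrullDim (R ⧸ p ⊔ Ideal.span {r}) < b := by
  have hr' : Ideal.Quotient.mk p r ∈ nonZeroDivisors (R ⧸ p) :=
    mem_nonZeroDivisors_of_ne_zero (by rwa [Ne, Ideal.Quotient.eq_zero_iff_mem])
  have h1 := ringKrullDim_quotient_succ_le_of_nonZeroDivisor hr'
  have h2 : ringKrullDim (R ⧸ p ⊔ Ideal.span {r}) =
      ringKrullDim ((R ⧸ p) ⧸ Ideal.span {Ideal.Quotient.mk p r}) := by
    rw [← Set.image_singleton, ← Ideal.map_span]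
    exact ringKrullDim_eq_of_ringEquiv (DoubleQuot.quotQuotEquivQuotSup p _).symm
  rw [h2]
  have h3 := h1.trans_lt hb
  by_contra! h4
  have h5 : ((b + 1 : ℕ) : WithBot ℕ∞) ≤
      ringKrullDim ((R ⧸ p) ⧸ Ideal.span {Ideal.Quotient.mk p r}) + 1 := by
    push_cast
    gcongr
  exact absurd h3 (not_lt.2 h5)

open scoped Pointwise in
lemma sup_span_le_annihilator_quotSMulTop (r : R) :
    Module.annihilator R N ⊔ Ideal.span {r} ≤ Module.annihilator R (QuotSMulTop r N) := by
  refine sup_le ((Submodule.mkQ _).annihilator_le_of_surjective (Submodule.mkQ_surjective _)) ?_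
  rw [Ideal.span_singleton_le_iff_mem, Module.mem_annihilator]
  intro x
  obtain ⟨x, rfl⟩ := Submodule.mkQ_surjective _ x
  rw [← map_smul]
  exact (Submodule.Quotient.mk_eq_zero _).2
    (Submodule.smul_mem_pointwise_smul _ _ _ Submodule.mem_top)

lemma vanish_of_forall_smul_eq_zero (h : ∀ j, ∀ x : N, y j • x = 0) (i : ℕ) :
    (triv y N).Vanish (i + 1) := by
  intro t f _ _
  refine ⟨1, ?_⟩
  convert isBd_zero _ _ _
  funext S
  obtain ⟨j, hj⟩ : S.1.Nonempty := by
    rw [← Finset.card_pos, S.2]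
    omega
  rw [kTrans, pow_one, ← Finset.prod_erase_mul S.1 y hj, mul_smul, h, smul_zero]
  rfl

lemma vanish_of_ringKrullDim_lt [IsNoetherianRing R] (b : ℕ) (N : Type) [AddCommGroup N]
    [Module R N] [Module.Finite R N] (hb : ringKrullDim (R ⧸ Module.annihilator R N) < b) {i : ℕ}
    (hi : b ≤ i) : (triv y N).Vanish i := by
  induction b generalizing N i with
  | zero =>
    have h : Subsingleton N := by
      rw [← Module.annihilator_eq_top_iff (R := R), ← Ideal.Quotient.subsingleton_iff]
      by_contra hns
      rw [not_subsingleton_iff_nontrivial] at hns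
      exact absurd hb (not_lt.2 (by simpa using ringKrullDim_nonneg_of_nontrivial))
    exact vanish_of_subsingleton _ _
  | succ b ih =>
    obtain ⟨i, rfl⟩ : ∃ k, i = k + 1 := ⟨i - 1, by omega⟩
    refine IsNoetherianRing.induction_on_isQuotientEquivQuotientPrime R
      (motive := fun N _ _ _ => ringKrullDim (R ⧸ Module.annihilator R N) < (b + 1 : ℕ) →
        (triv y N).Vanish (i + 1)) ‹Module.Finite R N› ?_ ?_ ?_ hb
    · intro N _ _ _ _ _
      exact vanish_of_subsingleton _ _
    · intro N _ _ _ p e hN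
      have hp := p.2
      have hann : Module.annihilator R N = p.1 := by
        rw [e.annihilator_eq, Ideal.annihilator_quotient]
      rw [hann] at hN
      by_cases hy : ∀ j, y j ∈ p.1
      · refine vanish_of_forall_smul_eq_zero (fun j x => ?_) i
        have h := hy j
        rw [← hann, Module.mem_annihilator] at h
        exact h x
      · push Not at hy
        obtain ⟨j, hj⟩ := hy
        have hreg : IsSMulRegular N (y j) := by
          refine isSMulRegular_iff_right_eq_zero_of_smul.2 fun x hx => ?_
          have h := congrArg e hx
          rw [map_smul, map_zero, Algebra.smul_def, mul_eq_zero] at h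
          rcases h with h | h
          · exact absurd (Ideal.Quotient.eq_zero_iff_mem.1 h) hj
          · exact (map_eq_zero_iff e e.injective).1 h
        refine vanish_succ_of_isSMulRegular
          (Ideal.le_radical (Ideal.subset_span ⟨j, rfl⟩)) hreg (ih _ ?_ (by omega))
        refine (ringKrullDim_quotient_anti ?_).trans_lt (ringKrullDim_quotient_sup_span_lt hj hN)
        rw [← hann]
        exact sup_span_le_annihilator_quotSMulTop (y j)
    · intro N₁ _ _ _ N₂ _ _ _ N₃ _ _ _ f g hf hg hfg h₁ h₃ h₂
      exact Vanish.middle (PA := triv y N₁) hf hg hfg (fun _ _ _ => rfl)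
        (h₁ ((ringKrullDim_quotient_anti (f.annihilator_le_of_injective hf)).trans_lt h₂))
        (h₃ ((ringKrullDim_quotient_anti (g.annihilator_le_of_surjective hg)).trans_lt h₂))

lemma lt_succ_of_le_natCast {x : WithBot ℕ∞} {b : ℕ} (h : x ≤ b) : x < (b + 1 : ℕ) :=
  h.trans_lt (by exact_mod_cast Nat.lt_succ_self b)

end Vanishing

section Complex

open KProj

variable {y} {C : ℕ → Type} [∀ j, AddCommGroup (C j)] [∀ j, Module R (C j)]
  {dl : ∀ j, C (j + 1) →ₗ[R] C j}

lemma p_mem_range {A B : Type} [AddCommGroup A] [Module R A] [AddCommGroup B] [Module R B]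
    {PA : KProj y A} {PB : KProj y B} {φ : A →ₗ[R] B}
    (h : ∀ t S x, φ (PA.p t S x) = PB.p t S (φ x)) (t : ℕ) (S : Finset (Fin n)) :
    ∀ x ∈ LinearMap.range φ, PB.p t S x ∈ LinearMap.range φ := by
  rintro _ ⟨x, rfl⟩
  exact ⟨_, h t S x⟩

lemma p_mem_ker {A B : Type} [AddCommGroup A] [Module R A] [AddCommGroup B] [Module R B]
    {PA : KProj y A} {PB : KProj y B} {φ : A →ₗ[R] B}
    (h : ∀ t S x, φ (PA.p t S x) = PB.p t S (φ x)) (t : ℕ) (S : Finset (Fin n)) :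
    ∀ x ∈ LinearMap.ker φ, PA.p t S x ∈ LinearMap.ker φ := by
  intro x hx
  rw [LinearMap.mem_ker] at hx ⊢
  rw [h, hx, map_zero]

lemma vanish_range_of_complex [IsNoetherianRing R] (d : ℕ) (hdim : ringKrullDim R ≤ d)
    (hCfin : ∀ j, Module.Finite R (C j))
    (hcomplex : ∀ j, (dl j).comp (dl (j + 1)) = 0) (P : ∀ j, KProj y (C j))
    (hP : ∀ j t S x, dl j ((P (j + 1)).p t S x) = (P j).p t S (dl j x))
    (hvan : ∀ j ≤ d, (P j).Vanish j)
    (hHdim : ∀ j : ℕ, modDimLE (R := R) (Hmod C dl j) (j + 1)) (k : ℕ) :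
    ∀ j, j + k = d →
      ((P j).restrict (LinearMap.range (dl j)) (p_mem_range (hP j))).Vanish (j + 1) := by
  induction k with
  | zero =>
    rintro j rfl
    refine Vanish.of_triv (vanish_of_ringKrullDim_lt (j + 1) _ ?_ le_rfl) _
    exact lt_succ_of_le_natCast ((ringKrullDim_quotient_le _).trans hdim)
  | succ k ih =>
    intro j hj
    have hB := ih (j + 1) (by omega)
    have hle : LinearMap.range (dl (j + 1)) ≤ LinearMap.ker (dl j) :=
      LinearMap.range_le_ker_iff.2 (hcomplex j)
    have hH : (triv y (Hmod C dl j)).Vanish (j + 1 + 1) :=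
      vanish_of_ringKrullDim_lt (j + 1 + 1) _ (lt_succ_of_le_natCast (hHdim j)) le_rfl
    have hZ : ((P (j + 1)).restrict (LinearMap.ker (dl j)) (p_mem_ker (hP j))).Vanish
        (j + 1 + 1) := by
      refine Vanish.middle (α := Submodule.inclusion hle) (g := Submodule.mkQ _)
        (Submodule.inclusion_injective hle) (Submodule.mkQ_surjective _) ?_
        (fun _ _ _ => rfl) hB hH
      rw [LinearMap.exact_iff, Submodule.ker_mkQ, Submodule.range_inclusion]
    refine Vanish.right (α := (LinearMap.ker (dl j)).subtype) (g := (dl j).rangeRestrict)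
      (PB := P (j + 1)) (PC := (P j).restrict _ (p_mem_range (hP j)))
      (Submodule.subtype_injective _) (dl j).surjective_rangeRestrict ?_
      (fun _ _ _ => rfl) (fun t S x => Subtype.ext (hP j t S x)) (hvan (j + 1) (by omega)) hZ
    rw [LinearMap.exact_iff, LinearMap.ker_rangeRestrict, Submodule.range_subtype]

lemma vanish_zero_of_complex [IsNoetherianRing R] (d : ℕ) (hdim : ringKrullDim R ≤ d)
    (hCfin : ∀ j, Module.Finite R (C j))
    (hcomplex : ∀ j, (dl j).comp (dl (j + 1)) = 0) (P : ∀ j, KProj y (C j))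
    (hP : ∀ j t S x, dl j ((P (j + 1)).p t S x) = (P j).p t S (dl j x))
    (hvan : ∀ j ≤ d, (P j).Vanish j)
    (hHdim : ∀ j : ℕ, modDimLE (R := R) (Hmod C dl j) (j + 1))
    (PM : KProj y M) {π : C 0 →ₗ[R] M} (hπsurj : Function.Surjective π)
    (hπker : LinearMap.ker π = LinearMap.range (dl 0))
    (hπ : ∀ t S x, π ((P 0).p t S x) = PM.p t S (π x)) : PM.Vanish 0 := by
  refine Vanish.right (α := (LinearMap.range (dl 0)).subtype) (g := π)
      (Submodule.subtype_injective _) hπsurj ?_ (fun _ _ _ => rfl) hπ (hvan 0 (Nat.zero_le d))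
      (vanish_range_of_complex d hdim hCfin hcomplex P hP hvan hHdim d 0 (zero_add d))
  rw [LinearMap.exact_iff, Submodule.range_subtype, hπker]

lemma eq_zero_of_vanish_zero {PM : KProj y M} (h : PM.Vanish 0) (t : ℕ) {x : M}
    (hP : PM.p t ∅ x = x) (hx : ∀ j, y j ^ t • x = 0) : x = 0 := by
  obtain ⟨s, hs⟩ := h t (fun _ => x) (by
    funext T
    simp [kd, hx]) (by
    rintro ⟨S, hS⟩
    obtain rfl : S = ∅ := Finset.card_eq_zero.1 hS
    exact hP)
  have hs : kTrans y s 0 (fun _ => x) = 0 := hs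
  simpa [kTrans] using congrFun hs ⟨∅, rfl⟩

lemma exists_pow_smul_eq_zero {I : Ideal R} (hy : ∀ j, y j ∈ I.radical) {x : M}
    (hx : x ∈ torsionSubmodule I M) : ∃ t : ℕ, ∀ j, y j ^ t • x = 0 := by
  obtain ⟨T, hT⟩ := hx
  choose a ha using hy
  refine ⟨(∑ j, a j) * T, fun j => hT _ ?_⟩
  rw [pow_mul]
  refine Ideal.pow_mem_pow ?_ T
  exact Ideal.pow_mem_of_pow_mem _ (ha j) (Finset.single_le_sum (fun _ _ => Nat.zero_le _)
    (Finset.mem_univ j))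

lemma vanish_of_depthGE {I : Ideal R} (hI : I ≤ (Ideal.span (Set.range y)).radical) {j : ℕ}
    (h : depthGE I M (j + 1)) (P : KProj y M) : P.Vanish j := by
  rcases h with h | ⟨rs, hlen, hrs, hreg⟩
  · exact vanish_of_subsingleton _ _
  · exact Vanish.of_triv (vanish_of_isWeaklyRegular rs M (fun r hr => hI (hrs r hr))
      hreg.toIsWeaklyRegular (by omega)) P

end Complex

section Graded

open KProj DirectSum

variable {y} (𝒜 : ℤ → AddSubgroup R)
  {N : Type} [AddCommGroup N] [Module R N]

/-- The projection of a graded module to its component of degree `k`. -/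
def gradedProj (𝒩 : ℤ → AddSubgroup N) [DirectSum.Decomposition 𝒩] (k : ℤ) : N →+ N where
  toFun x := (decompose 𝒩 x k : N)
  map_zero' := by simp
  map_add' x z := by simp

lemma gradedProj_of_mem (𝒩 : ℤ → AddSubgroup N) [DirectSum.Decomposition 𝒩] {k : ℤ} {x : N}
    (hx : x ∈ 𝒩 k) (l : ℤ) : gradedProj 𝒩 l x = if k = l then x else 0 := by
  split_ifs with h
  · subst h
    exact decompose_of_mem_same 𝒩 hx
  · exact decompose_of_mem_ne 𝒩 hx h

lemma gradedProj_mem (𝒩 : ℤ → AddSubgroup N) [DirectSum.Decomposition 𝒩] (k : ℤ) (x : N) :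
    gradedProj 𝒩 k x ∈ 𝒩 k := (decompose 𝒩 x k).2

lemma gradedProj_map {N' : Type} [AddCommGroup N'] (𝒩 : ℤ → AddSubgroup N)
    [DirectSum.Decomposition 𝒩] (𝒩' : ℤ → AddSubgroup N') [DirectSum.Decomposition 𝒩']
    (φ : N →+ N') (a : ℤ) (hφ : ∀ k, ∀ x ∈ 𝒩 k, φ x ∈ 𝒩' (k + a)) (k : ℤ) (x : N) :
    φ (gradedProj 𝒩 k x) = gradedProj 𝒩' (k + a) (φ x) := by
  induction x using DirectSum.Decomposition.inductionOn 𝒩 with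
  | zero => simp
  | @homogeneous i m =>
    rw [gradedProj_of_mem 𝒩 m.2, gradedProj_of_mem 𝒩' (hφ i m m.2)]
    by_cases h : i = k <;> simp [h]
  | add x z hx hz => simp [hx, hz]

lemma gradedProj_smul (𝒩 : ℤ → AddSubgroup N) [DirectSum.Decomposition 𝒩]
    [SetLike.GradedSMul 𝒜 𝒩] {a : ℤ} {r : R} (hr : r ∈ 𝒜 a) (k : ℤ) (x : N) :
    gradedProj 𝒩 (k + a) (r • x) = r • gradedProj 𝒩 k x := by
  refine (gradedProj_map 𝒩 𝒩 (DistribSMul.toAddMonoidHom N r) a (fun k x hx => ?_) k x).symm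
  rw [add_comm]
  exact SetLike.GradedSMul.smul_mem hr hx

/-- The projections to the homogeneous part of degree `ℓ` of the Koszul complexes. -/
def KProj.graded [GradedRing 𝒜] {e : Fin n → ℤ} (hy : ∀ j, y j ∈ 𝒜 (e j)) (𝒩 : ℤ → AddSubgroup N)
    [DirectSum.Decomposition 𝒩] [SetLike.GradedSMul 𝒜 𝒩] (ℓ : ℤ) : KProj y N where
  p t S := gradedProj 𝒩 (ℓ + (t : ℤ) * ∑ j ∈ S, e j)
  p_p t S x := by rw [gradedProj_of_mem 𝒩 (gradedProj_mem 𝒩 _ x), if_pos rfl]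
  p_smul t T j hj x := by
    have h : y j ^ t ∈ 𝒜 (t * e j) := by
      simpa using SetLike.pow_mem_graded t (hy j)
    rw [← gradedProj_smul 𝒜 𝒩 h, ← Finset.add_sum_erase T e hj]
    congr 2
    ring
  p_trans t s S x := by
    have h : (∏ j ∈ S, y j) ^ s ∈ 𝒜 (s * ∑ j ∈ S, e j) := by
      simpa using SetLike.pow_mem_graded s
        (SetLike.prod_mem_graded 𝒜 e y fun j _ => hy j)
    rw [← gradedProj_smul 𝒜 𝒩 h]
    congr 2
    push_cast
    ring

lemma vanish_graded_of_kVanish [GradedRing 𝒜] {e : Fin n → ℤ} (hy : ∀ j, y j ∈ 𝒜 (e j))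
    (𝒩 : ℤ → AddSubgroup N) [DirectSum.Decomposition 𝒩] [SetLike.GradedSMul 𝒜 𝒩] {ℓ : ℤ} {i : ℕ}
    (h : KVanish y 𝒩 e i ℓ) : (KProj.graded 𝒜 hy 𝒩 ℓ).Vanish i := by
  intro t f hf hP
  obtain ⟨s, hs⟩ := h t f hf fun S => by
    rw [← hP S]
    exact gradedProj_mem _ _ _
  refine ⟨s, ?_⟩
  rw [← (hP.kTrans s).proj_eq]
  refine IsBd.proj ?_ _
  cases i with
  | zero => exact hs
  | succ i =>
    obtain ⟨g, hg⟩ := hs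
    exact ⟨g, homog_triv _ _, hg⟩

/-- A finite product of families of projections. -/
def KProj.pi {κ : Type} (P : κ → KProj y N) : KProj y (κ → N) where
  p t S := AddMonoidHom.mk' (fun v k => (P k).p t S (v k)) fun v w => by
    funext k
    simp
  p_p t S v := funext fun k => (P k).p_p t S (v k)
  p_smul t T j hj v := funext fun k => (P k).p_smul t T j hj (v k)
  p_trans t s S v := funext fun k => (P k).p_trans t s S (v k)

lemma vanish_pi {κ : Type} [Fintype κ] {P : κ → KProj y N} {i : ℕ} (h : ∀ k, (P k).Vanish i) :
    (KProj.pi P).Vanish i := by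
  intro t f hf hP
  choose s hs using fun k => h k t (fun S => f S k)
    ((kd_map y (LinearMap.proj (R := R) (φ := fun _ : κ => N) k) t i f).trans
      (by rw [hf]; rfl)) (fun S => congrFun (hP S) k)
  have hs' : ∀ k, (P k).IsBd (t + ∑ k, s k) i
      (fun S => kTrans y (∑ k, s k) i f S k) := fun k => by
    have h1 := (hs k).kTrans_of_le (Finset.single_le_sum (fun _ _ => Nat.zero_le _)
      (Finset.mem_univ k) : s k ≤ ∑ k, s k)
    rwa [show (fun S => f S k) = fun S =>
      LinearMap.proj (R := R) (φ := fun _ : κ => N) k (f S) from rfl, kTrans_map] at h1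
  refine ⟨∑ k, s k, ?_⟩
  cases i with
  | zero =>
    funext S k
    exact congrFun (hs' k) S
  | succ i =>
    choose g hg hgd using hs'
    refine ⟨fun S k => g k S, fun S => funext fun k => hg k S, ?_⟩
    funext S k
    rw [← congrFun (hgd k) S]
    exact (congrFun (kd_map y (LinearMap.proj (R := R) (φ := fun _ : κ => N) k) _ i
      (fun S k => g k S)) S).symm

lemma exists_homogeneous_generators [Module.Finite R N] {𝒩 : ℤ → AddSubgroup N} {β : ℤ}
    (h : GenDegLE (R := R) 𝒩 β) : ∃ s : Finset N, Submodule.span R (s : Set N) = ⊤ ∧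
      ∀ x : s, ∃ b ≤ β, (x : N) ∈ 𝒩 b := by
  have hfg : (Submodule.span R (⋃ (j : ℤ) (_ : j ≤ β), (𝒩 j : Set N))).FG := by
    rw [show Submodule.span R _ = ⊤ from h]
    exact Module.Finite.fg_top
  obtain ⟨s, hs, hspan⟩ := (Submodule.fg_span_iff_fg_span_finset_subset _).1 hfg
  refine ⟨s, hspan.symm.trans h, fun x => ?_⟩
  simpa using hs x.2

lemma vanish_of_genDegLE [GradedRing 𝒜] [IsNoetherianRing R] [Module.Finite R N] {d : ℕ}
    (hdim : ringKrullDim R ≤ d) {e : Fin n → ℤ} (hy : ∀ j, y j ∈ 𝒜 (e j))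
    (𝒩 : ℤ → AddSubgroup N) [DirectSum.Decomposition 𝒩] [SetLike.GradedSMul 𝒜 𝒩] {β γ : ℤ}
    (hgen : GenDegLE (R := R) 𝒩 β)
    (hR : ∀ ℓ : ℤ, γ < ℓ → KVanish y (fun j => 𝒜 j) e d ℓ) {ℓ : ℤ} (hℓ : β + γ < ℓ) :
    (KProj.graded 𝒜 hy 𝒩 ℓ).Vanish d := by
  obtain ⟨s, hs, hb⟩ := exists_homogeneous_generators hgen
  choose b hbβ hb using hb
  let P : KProj y (s → R) := KProj.pi fun k => KProj.graded 𝒜 hy 𝒜 (ℓ - b k)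
  let φ : (s → R) →ₗ[R] N := Fintype.linearCombination R (fun k : s => (k : N))
  have hφ : ∀ t S v, φ (P.p t S v) = (KProj.graded 𝒜 hy 𝒩 ℓ).p t S (φ v) := by
    intro t S v
    simp only [φ, Fintype.linearCombination_apply, map_sum]
    refine Finset.sum_congr rfl fun k _ => ?_
    have h := gradedProj_map 𝒜 𝒩 (LinearMap.toSpanSingleton R N (k : N)).toAddMonoidHom (b k)
      (fun a r hr => SetLike.GradedSMul.smul_mem hr (hb k))
      (ℓ - b k + t * ∑ j ∈ S, e j) (v k)
    rw [show ℓ - b k + t * ∑ j ∈ S, e j + b k = ℓ + t * ∑ j ∈ S, e j by ring] at h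
    exact h
  have hsurj : Function.Surjective φ := by
    rw [← LinearMap.range_eq_top, Fintype.range_linearCombination, ← hs]
    simp
  refine Vanish.right (PA := P.restrict (LinearMap.ker φ) (p_mem_ker hφ)) (PB := P)
    (α := (LinearMap.ker φ).subtype) (g := φ) (Submodule.subtype_injective _) hsurj ?_
    (fun _ _ _ => rfl) hφ ?_ ?_
  · rw [LinearMap.exact_iff, Submodule.range_subtype]
  · refine vanish_pi fun k => vanish_graded_of_kVanish 𝒜 hy 𝒜 (hR _ ?_)
    have := hbβ k
    omega
  · refine Vanish.of_triv (vanish_of_ringKrullDim_lt (d + 1) _ ?_ le_rfl) _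
    exact lt_succ_of_le_natCast ((ringKrullDim_quotient_le _).trans hdim)

end Graded

theorem statement1
    (𝒜 : ℤ → AddSubgroup R) [GradedRing 𝒜]
    (hNoeth : IsNoetherianRing R)
    (hnonneg : ∀ i : ℤ, i < 0 → 𝒜 i = ⊥)
    (hloc : IsLocalRing ↥(𝒜 0))
    (d : ℕ) (hdim : ringKrullDim R = (d : WithBot (WithTop ℕ)))
    (M : Type) [AddCommGroup M] [Module R M]
    (ℳ : ℤ → AddSubgroup M) [DirectSum.Decomposition ℳ] [SetLike.GradedSMul 𝒜 ℳ]
    (C : ℕ → Type) [∀ j, AddCommGroup (C j)] [∀ j, Module R (C j)]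
    (hCfin : ∀ j, Module.Finite R (C j))
    (dl : ∀ j, C (j + 1) →ₗ[R] C j)
    (hcomplex : ∀ j, (dl j).comp (dl (j + 1)) = 0)
    (𝒞 : ∀ j, ℤ → AddSubgroup (C j))
    [∀ j, DirectSum.Decomposition (𝒞 j)] [∀ j, SetLike.GradedSMul 𝒜 (𝒞 j)]
    (hdlhomog : ∀ (j : ℕ) (ℓ : ℤ), ∀ x ∈ 𝒞 (j + 1) ℓ, dl j x ∈ 𝒞 j ℓ)
    (π : C 0 →ₗ[R] M) (hπsurj : Function.Surjective π)
    (hπker : LinearMap.ker π = LinearMap.range (dl 0))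
    (hπhomog : ∀ (ℓ : ℤ), ∀ x ∈ 𝒞 0 ℓ, π x ∈ ℳ ℓ)
    -- hypothesis (a): `j + 1 ≤ depth C_j` for `0 ≤ j ≤ d - 1`
    (hdepth : ∀ j : ℕ, (j : ℤ) ≤ (d : ℤ) - 1 → depthGE (maxHomIdeal 𝒜) (C j) (j + 1))
    -- hypothesis (b): `dim H_j(C_•) ≤ j` for all `j ≥ 1`
    (hHdim : ∀ jm1 : ℕ, modDimLE (R := R) (Hmod C dl jm1) (jm1 + 1)) :
    -- (i) if `C_d = 0` then `H⁰_𝔪(M) = 0`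
    (Subsingleton (C d) → torsionSubmodule (maxHomIdeal 𝒜) M = ⊥)
    -- (ii) if `C_d ≠ 0` then `[H⁰_𝔪(M)]_ℓ = 0` for all `ℓ > b₀(C_d) + a(R)`
    ∧ (Nontrivial (C d) →
        ∀ (m : ℕ) (y : Fin m → R) (e : Fin m → ℤ),
        (∀ j, y j ∈ 𝒜 (e j)) →
        (Ideal.span (Set.range y)).radical = (maxHomIdeal 𝒜).radical →
        ∀ β γ : ℤ, GenDegLE (R := R) (𝒞 d) β →
          (∀ ℓ : ℤ, γ < ℓ → KVanish y (fun j => 𝒜 j) e d ℓ) →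
          ∀ ℓ : ℤ, β + γ < ℓ →
            ∀ x ∈ torsionSubmodule (maxHomIdeal 𝒜) M, x ∈ ℳ ℓ → x = 0) := by
  have hdim' : ringKrullDim R ≤ d := hdim.le
  refine ⟨fun hCd => ?_, fun _ m y e hy hrad β γ hgen hR ℓ hℓ x hx hxℓ => ?_⟩
  · obtain ⟨m, y, hspan⟩ := Submodule.fg_iff_exists_fin_generating_family.1
      (IsNoetherian.noetherian (maxHomIdeal 𝒜))
    have hI : maxHomIdeal 𝒜 ≤ (Ideal.span (Set.range y)).radical := hspan.ge.trans Ideal.le_radical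
    refine (Submodule.eq_bot_iff _).2 fun x hx => ?_
    have hvan : (KProj.triv y M).Vanish 0 := by
      refine vanish_zero_of_complex d hdim' hCfin hcomplex (fun j => KProj.triv y (C j))
        (fun _ _ _ _ => rfl) (fun j hj => ?_) hHdim _ hπsurj hπker (fun _ _ _ => rfl)
      rcases hj.lt_or_eq with hj | rfl
      · exact vanish_of_depthGE hI (hdepth j (by omega)) _
      · exact KProj.vanish_of_subsingleton _ _
    obtain ⟨t, ht⟩ := exists_pow_smul_eq_zero (y := y)
      (fun j => Ideal.le_radical (hspan.le (Submodule.subset_span ⟨j, rfl⟩))) hx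
    exact eq_zero_of_vanish_zero hvan t rfl ht
  · have hI : maxHomIdeal 𝒜 ≤ (Ideal.span (Set.range y)).radical :=
      hrad.ge.trans' Ideal.le_radical
    have hvan : (KProj.graded 𝒜 hy ℳ ℓ).Vanish 0 := by
      refine vanish_zero_of_complex d hdim' hCfin hcomplex
        (fun j => KProj.graded 𝒜 hy (𝒞 j) ℓ) (fun j t S x => ?_) (fun j hj => ?_) hHdim _
        hπsurj hπker (fun t S x => ?_)
      · simpa [KProj.graded] using gradedProj_map (𝒞 (j + 1)) (𝒞 j) (dl j).toAddMonoidHom 0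
          (by simpa using hdlhomog j) _ x
      · rcases hj.lt_or_eq with hj | rfl
        · exact vanish_of_depthGE hI (hdepth j (by omega)) _
        · exact vanish_of_genDegLE 𝒜 hdim' hy (𝒞 j) hgen hR hℓ
      · simpa [KProj.graded] using gradedProj_map (𝒞 0) ℳ π.toAddMonoidHom 0 (by simpa using hπhomog) _ x
    obtain ⟨t, ht⟩ := exists_pow_smul_eq_zero (y := y)
      (fun j => hrad.le (Ideal.le_radical (Ideal.subset_span ⟨j, rfl⟩))) hx
    refine eq_zero_of_vanish_zero hvan t ?_ ht
    simpa [KProj.graded] using gradedProj_of_mem ℳ hxℓ ℓ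

end Paper
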